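/- Let θ > 0, let K_u, K_v ⊂ ℝ be finite unions of disjoint compact intervals with K_v ⊆ K_u, and let φ_u : K_u → ℝ, φ_v : K_v → ℝ be continuous with φ_u(x₁) ≥ φ_v(x₁) for every x₁ ∈ K_v. Let u, v : B₂ ⊂ ℝ² → ℝ be continuous, even in x₂, and solve the two-phase problem with obstacles φ_u, φ_v on K_u, K_v respectively, in the following sense: u is harmonic in B₂ ∖ (K_u × {0}); for every x₁ ∈ K_u with (x₁,0) ∈ B₂, the one-sided derivative ψ_u(x₁) := ∂₂u(x₁,0⁺) := lim_{t→0⁺}(u(x₁,t) − u(x₁,0))/t exists and satisfies −2πθ ≤ ψ_u(x₁) ≤ 0, with ψ_u(x₁) = 0 whenever u(x₁,0) > φ_u(x₁) and ψ_u(x₁) = −2πθ whenever u(x₁,0) < φ_u(x₁); and the analogous conditions hold for v with K_v, φ_v. Then (v−u)_+ := max(v−u, 0) is subharmonic in B₂, i.e. for every z ∈ B₂ and r > 0 with the closed ball of radius r centered at z contained in B₂, (v−u)_+(z) is at most the average of (v−u)_+ over the sphere ∂B_r(z). -/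

import Mathlib

open MeasureTheory Set

/-- The open (Euclidean) ball of radius 2 in `ℝ²`. -/
def ball2 : Set (ℝ × ℝ) := {p | p.1^2 + p.2^2 < 4}

/-- Laplacian of a function on `ℝ²`, computed through iterated coordinate derivatives. -/
noncomputable def lap2 (u : ℝ × ℝ → ℝ) (p : ℝ × ℝ) : ℝ :=
  deriv (deriv (fun t => u (t, p.2))) p.1 + deriv (deriv (fun t => u (p.1, t))) p.2

/-- `u` is harmonic on the open set `U ⊆ ℝ²`: it is `C²` there and its Laplacian vanishes. -/
def HarmonicOn2 (u : ℝ × ℝ → ℝ) (U : Set (ℝ × ℝ)) : Prop :=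
  ContDiffOn ℝ 2 u U ∧ ∀ p ∈ U, lap2 u p = 0

/-- `K` is a finite (nonempty) union of pairwise disjoint compact intervals. -/
def FinUnionIntervals (K : Set ℝ) : Prop :=
  ∃ (N : ℕ) (a b : Fin N → ℝ), 0 < N ∧ (∀ i, a i < b i) ∧
    (∀ i j, i ≠ j → Disjoint (Set.Icc (a i) (b i)) (Set.Icc (a j) (b j))) ∧
    K = ⋃ i, Set.Icc (a i) (b i)

/-- `u` solves the two-phase obstacle problem in `B₂` on `K` with obstacle `φ`, with
`ψ` the one-sided vertical derivative of `u` on `{x₂ = 0}`. -/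
def TwoPhaseSol2 (θ : ℝ) (K : Set ℝ) (φ : ℝ → ℝ) (u : ℝ × ℝ → ℝ) (ψ : ℝ → ℝ) : Prop :=
  HarmonicOn2 u (ball2 \ {p : ℝ × ℝ | p.1 ∈ K ∧ p.2 = 0}) ∧
  ∀ x₁ ∈ K, (x₁, (0:ℝ)) ∈ ball2 →
    Filter.Tendsto (fun t => (u (x₁, t) - u (x₁, 0)) / t)
      (nhdsWithin 0 (Set.Ioi 0)) (nhds (ψ x₁)) ∧
    -(2 * Real.pi * θ) ≤ ψ x₁ ∧ ψ x₁ ≤ 0 ∧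
    (φ x₁ < u (x₁, 0) → ψ x₁ = 0) ∧
    (u (x₁, 0) < φ x₁ → ψ x₁ = -(2 * Real.pi * θ))


theorem IsLocalMax.deriv_deriv_nonpos {f : ℝ → ℝ} {x : ℝ} (h : IsLocalMax f x)
    (hc : ContinuousAt f x) : deriv (deriv f) x ≤ 0 := by
  by_contra! hpos
  have hmin := isLocalMin_of_deriv_deriv_pos hpos h.deriv_eq_zero hc
  have heq : f =ᶠ[nhds x] fun _ => f x := by
    filter_upwards [h, hmin] with y h₁ h₂ using le_antisymm h₁ h₂
  have : deriv (deriv f) x = 0 := by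
    rw [heq.deriv.deriv_eq]
    simp
  exact hpos.ne' this

theorem lap2_sub {f g : ℝ × ℝ → ℝ} {p : ℝ × ℝ} (hf : ContDiffAt ℝ 2 f p)
    (hg : ContDiffAt ℝ 2 g p) : lap2 (fun q => f q - g q) p = lap2 f p - lap2 g p := by
  have key : ∀ {F G : ℝ → ℝ} {x : ℝ}, ContDiffAt ℝ 2 F x → ContDiffAt ℝ 2 G x →
      deriv (deriv fun t => F t - G t) x = deriv (deriv F) x - deriv (deriv G) x := by
    intro F G x hF hG
    have := iteratedDeriv_fun_sub (n := 2) hF hG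
    simpa [iteratedDeriv_succ, iteratedDeriv_zero] using this
  have e₁ : ContDiffAt ℝ 2 (fun t : ℝ => (t, p.2)) p.1 := by fun_prop
  have e₂ : ContDiffAt ℝ 2 (fun t : ℝ => (p.1, t)) p.2 := by fun_prop
  have h₁ := key (hf.comp p.1 e₁) (hg.comp p.1 e₁)
  have h₂ := key (hf.comp p.2 e₂) (hg.comp p.2 e₂)
  simp only [Function.comp_def] at h₁ h₂
  simp only [lap2, h₁, h₂]
  ring

/-- At a local maximum of a `C²` function the Laplacian is nonpositive. -/
theorem lap2_nonpos_of_isLocalMax {f : ℝ × ℝ → ℝ} {p : ℝ × ℝ} (hf : ContinuousAt f p)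
    (h : IsLocalMax f p) : lap2 f p ≤ 0 := by
  have e₁ : ContinuousAt (fun t : ℝ => (t, p.2)) p.1 := by fun_prop
  have e₂ : ContinuousAt (fun t : ℝ => (p.1, t)) p.2 := by fun_prop
  have h₁ := IsLocalMax.deriv_deriv_nonpos (f := fun t => f (t, p.2)) (x := p.1)
    (e₁.eventually h) (ContinuousAt.comp (f := fun t : ℝ => (t, p.2)) hf e₁)
  have h₂ := IsLocalMax.deriv_deriv_nonpos (f := fun t => f (p.1, t)) (x := p.2)
    (e₂.eventually h) (ContinuousAt.comp (f := fun t : ℝ => (p.1, t)) hf e₂)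
  unfold lap2
  linarith

/-- The real part of a complex polynomial, as a function on `ℝ × ℝ`. -/
noncomputable def rePoly (R : Polynomial ℂ) (p : ℝ × ℝ) : ℝ :=
  (R.eval (p.1 + p.2 * Complex.I)).re

theorem contDiff_rePoly (R : Polynomial ℂ) : ContDiff ℝ 2 (rePoly R) := by
  have hR : ContDiff ℝ 2 fun z : ℂ => R.eval z :=
    (R.contDiff_aeval (𝕜 := ℂ) 2).restrict_scalars ℝ
  unfold rePoly
  refine Complex.reCLM.contDiff.comp (hR.comp ?_)
  exact ((Complex.ofRealCLM.contDiff.comp contDiff_fst).add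
    ((Complex.ofRealCLM.contDiff.comp contDiff_snd).mul contDiff_const))

theorem hasDerivAt_rePoly_fst (R : Polynomial ℂ) (x y : ℝ) :
    HasDerivAt (fun t => rePoly R (t, y)) (rePoly R.derivative (x, y)) x := by
  have h₁ : HasDerivAt (fun z : ℂ => R.eval (z + y * Complex.I))
      (R.derivative.eval ((x : ℂ) + y * Complex.I)) (x : ℂ) := by
    simpa [Function.comp_def] using (R.hasDerivAt ((x : ℂ) + y * Complex.I)).comp (x : ℂ)
      ((hasDerivAt_id (x : ℂ)).add_const (y * Complex.I))
  exact h₁.real_of_complex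

theorem hasDerivAt_rePoly_snd (R : Polynomial ℂ) (x y : ℝ) :
    HasDerivAt (fun t => rePoly R (x, t))
      (rePoly (Polynomial.C Complex.I * R.derivative) (x, y)) y := by
  have h₁ : HasDerivAt (fun z : ℂ => R.eval ((x : ℂ) + z * Complex.I))
      (Complex.I * R.derivative.eval ((x : ℂ) + y * Complex.I)) (y : ℂ) := by
    have := (R.hasDerivAt ((x : ℂ) + y * Complex.I)).comp (y : ℂ)
      (((hasDerivAt_id (y : ℂ)).mul_const Complex.I).const_add (x : ℂ))
    simpa [Function.comp_def, mul_comm] using this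
  simpa [rePoly] using h₁.real_of_complex

/-- The Laplacian of the harmonic function `rePoly R`, corrected by a linear and a quadratic
term. -/
theorem lap2_rePoly_sub (R : Polynomial ℂ) (a b : ℝ) (p : ℝ × ℝ) :
    lap2 (fun q => rePoly R q - a * q.2 - b * (q.1 ^ 2 + q.2 ^ 2)) p = -(4 * b) := by
  have h₁ : (deriv fun t => rePoly R (t, p.2) - a * p.2 - b * (t ^ 2 + p.2 ^ 2)) =
      fun t => rePoly R.derivative (t, p.2) - b * (2 * t) := by
    funext t
    have := ((hasDerivAt_rePoly_fst R t p.2).sub_const (a * p.2)).sub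
      ((((hasDerivAt_id t).pow 2).add_const (p.2 ^ 2)).const_mul b)
    simpa [Pi.sub_def] using this.deriv
  have h₂ : (deriv fun t => rePoly R (p.1, t) - a * t - b * (p.1 ^ 2 + t ^ 2)) =
      fun t => rePoly (Polynomial.C Complex.I * R.derivative) (p.1, t) - a - b * (2 * t) := by
    funext t
    have := ((hasDerivAt_rePoly_snd R p.1 t).sub ((hasDerivAt_id t).const_mul a)).sub
      ((((hasDerivAt_id t).pow 2).const_add (p.1 ^ 2)).const_mul b)
    simpa [Pi.sub_def] using this.deriv
  have h₃ := ((hasDerivAt_rePoly_fst R.derivative p.1 p.2).sub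
    (((hasDerivAt_id p.1).const_mul 2).const_mul b)).deriv
  have h₄ := (((hasDerivAt_rePoly_snd (Polynomial.C Complex.I * R.derivative) p.1 p.2).sub_const
    a).sub (((hasDerivAt_id p.2).const_mul 2).const_mul b)).deriv
  unfold lap2
  simp only [h₁, h₂]
  simp only [id, Pi.sub_def] at h₃ h₄
  rw [h₃, h₄]
  simp [rePoly, ← mul_assoc]
  ring

theorem exists_polynomial_near_on_circle {f : ℝ → ℝ} (hf : Continuous f)
    (hper : Function.Periodic f (2 * Real.pi)) {ε : ℝ} (hε : 0 < ε) :
    ∃ Q : Polynomial ℂ, ∀ t : ℝ, |f t - (Q.eval (Complex.exp (t * Complex.I))).re| < ε := by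
  have : Fact (0 < 2 * Real.pi) := ⟨Real.two_pi_pos⟩
  have hspan : ∀ F ∈ Submodule.span ℂ (range (@fourier (2 * Real.pi))),
      ∃ Q₁ Q₂ : Polynomial ℂ, ∀ t : ℝ, F (t : AddCircle (2 * Real.pi)) =
        Q₁.eval (Complex.exp (t * Complex.I)) +
          starRingEnd ℂ (Q₂.eval (Complex.exp (t * Complex.I))) := by
    intro F hF
    induction hF using Submodule.span_induction with
    | mem F hF =>
      obtain ⟨n, rfl⟩ := hF
      have hpi : (Real.pi : ℂ) ≠ 0 := by exact_mod_cast Real.pi_ne_zero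
      have hfour : ∀ t : ℝ, fourier n (t : AddCircle (2 * Real.pi)) =
          Complex.exp (t * Complex.I) ^ n := by
        intro t
        rw [fourier_coe_apply, ← Complex.exp_int_mul]
        congr 1
        push_cast
        field_simp
      obtain ⟨k, rfl | rfl⟩ := n.eq_nat_or_neg
      · exact ⟨Polynomial.X ^ k, 0, fun t => by simp [hfour]⟩
      · refine ⟨0, Polynomial.X ^ k, fun t => ?_⟩
        simp [hfour, ← Complex.exp_conj, Complex.exp_neg]
    | zero => exact ⟨0, 0, fun t => by simp⟩
    | add F G _ _ hF hG =>
      obtain ⟨A, B, h₁⟩ := hF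
      obtain ⟨A', B', h₂⟩ := hG
      exact ⟨A + A', B + B', fun t => by simp [h₁, h₂]; ring⟩
    | smul c F _ hF =>
      obtain ⟨A, B, h₁⟩ := hF
      exact ⟨Polynomial.C c * A, Polynomial.C (starRingEnd ℂ c) * B, fun t => by
        simp [h₁]; ring⟩
  let g : C(AddCircle (2 * Real.pi), ℂ) :=
    ⟨fun x => (hper.lift x : ℂ), Complex.continuous_ofReal.comp
      (continuous_coinduced_dom.mpr hf)⟩
  have hg : g ∈ (Submodule.span ℂ (range (@fourier (2 * Real.pi)))).topologicalClosure := by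
    rw [span_fourier_closure_eq_top]
    trivial
  obtain ⟨F, hF, hd⟩ := Metric.mem_closure_iff.mp hg ε hε
  obtain ⟨A, B, hAB⟩ := hspan F hF
  refine ⟨A + B, fun t => ?_⟩
  have h₁ := (ContinuousMap.dist_apply_le_dist (f := g) (g := F)
    (t : AddCircle (2 * Real.pi))).trans_lt hd
  have h₂ : g (t : AddCircle (2 * Real.pi)) = f t := by
    simp [g]
  rw [dist_eq_norm, hAB, h₂] at h₁
  refine lt_of_le_of_lt (le_of_eq_of_le ?_ (Complex.abs_re_le_norm _)) h₁
  simp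

theorem exists_rePoly_near_on_circle {f : ℝ → ℝ} (hf : Continuous f)
    (hper : Function.Periodic f (2 * Real.pi)) (z : ℝ × ℝ) {r : ℝ} (hr : 0 < r)
    {ε : ℝ} (hε : 0 < ε) :
    ∃ R : Polynomial ℂ, ∀ t : ℝ,
      |f t - rePoly R (z.1 + r * Real.cos t, z.2 + r * Real.sin t)| < ε := by
  obtain ⟨Q, hQ⟩ := exists_polynomial_near_on_circle hf hper hε
  refine ⟨Q.comp (Polynomial.C (r : ℂ)⁻¹ *
    (Polynomial.X - Polynomial.C (z.1 + z.2 * Complex.I))), fun t => ?_⟩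
  convert hQ t using 4
  have : (r : ℂ) ≠ 0 := by exact_mod_cast hr.ne'
  simp only [rePoly, Polynomial.eval_comp, Polynomial.eval_mul, Polynomial.eval_C,
    Polynomial.eval_sub, Polynomial.eval_X]
  congr 2
  rw [Complex.exp_mul_I]
  push_cast
  field_simp
  ring

theorem circleMap_eq_coords (z : ℝ × ℝ) (r t : ℝ) :
    circleMap (z.1 + z.2 * Complex.I) r t =
      (z.1 + r * Real.cos t : ℝ) + (z.2 + r * Real.sin t : ℝ) * Complex.I := by
  rw [circleMap, Complex.exp_mul_I]
  push_cast
  ring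

theorem rePoly_eq_average (R : Polynomial ℂ) (z : ℝ × ℝ) (r : ℝ) :
    (2 * Real.pi)⁻¹ * ∫ t in (0:ℝ)..(2 * Real.pi),
      rePoly R (z.1 + r * Real.cos t, z.2 + r * Real.sin t) = rePoly R z := by
  have hd : DiffContOnCl ℂ (fun c => R.eval c) (Metric.ball (z.1 + z.2 * Complex.I) |r|) :=
    R.differentiable.diffContOnCl
  have h := congrArg Complex.reCLM hd.circleAverage
  have hci : IntervalIntegrable (fun t => R.eval (circleMap (z.1 + z.2 * Complex.I) r t))
      volume 0 (2 * Real.pi) :=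
    (R.continuous.comp (continuous_circleMap _ _)).intervalIntegrable _ _
  rw [Real.circleAverage_def, map_smul,
    ← ContinuousLinearMap.intervalIntegral_comp_comm Complex.reCLM hci] at h
  simpa [rePoly, circleMap_eq_coords] using h

theorem exists_angle_of_mem_circle {z p : ℝ × ℝ} {r : ℝ} (hr : 0 < r)
    (hp : (p.1 - z.1) ^ 2 + (p.2 - z.2) ^ 2 = r ^ 2) :
    ∃ t : ℝ, p = (z.1 + r * Real.cos t, z.2 + r * Real.sin t) := by
  obtain ⟨c, hc⟩ : ∃ c : ℂ, c = ⟨p.1 - z.1, p.2 - z.2⟩ := ⟨_, rfl⟩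
  have hn : ‖c‖ = r := by
    rw [Complex.norm_eq_sqrt_sq_add_sq]
    simp [hc, hp, hr.le]
  refine ⟨c.arg, Prod.ext ?_ ?_⟩
  · have := Complex.norm_mul_cos_arg c
    rw [hn] at this
    simp only [this]
    simp [hc]
  · have := Complex.norm_mul_sin_arg c
    rw [hn] at this
    simp only [this]
    simp [hc]

theorem rePoly_nonneg_of_circle {R : Polynomial ℂ} {z : ℝ × ℝ} {r : ℝ} (hr : 0 < r)
    (h : ∀ t : ℝ, 0 ≤ rePoly R (z.1 + r * Real.cos t, z.2 + r * Real.sin t)) {p : ℝ × ℝ}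
    (hp : (p.1 - z.1) ^ 2 + (p.2 - z.2) ^ 2 ≤ r ^ 2) : 0 ≤ rePoly R p := by
  have hd : DiffContOnCl ℂ (fun c => Complex.exp (-R.eval c))
      (Metric.ball (z.1 + z.2 * Complex.I) r) :=
    (R.differentiable.neg.cexp).diffContOnCl
  have key := Complex.norm_le_of_forall_mem_frontier_norm_le (C := 1)
    Metric.isBounded_ball hd ?_ (z := p.1 + p.2 * Complex.I) ?_
  · rw [Complex.norm_exp, Real.exp_le_one_iff] at key
    simpa [rePoly] using key
  · intro c hc
    rw [frontier_ball _ hr.ne', ← abs_of_pos hr, ← range_circleMap] at hc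
    obtain ⟨t, rfl⟩ := hc
    rw [Complex.norm_exp, Real.exp_le_one_iff, circleMap_eq_coords]
    simpa [rePoly] using h t
  · rw [closure_ball _ hr.ne', Metric.mem_closedBall, dist_eq_norm,
      Complex.norm_eq_sqrt_sq_add_sq]
    exact Real.sqrt_le_iff.mpr ⟨hr.le, by simpa using hp⟩

/-- A function on `ball2`, even in the second variable, harmonic off the axis and with
nonnegative outward normal derivative at the points of the axis where it is positive, lies below
a nonnegative harmonic function on a disk as soon as it does so on the boundary circle. -/
theorem le_rePoly_of_le_on_circle {w : ℝ × ℝ → ℝ} {R : Polynomial ℂ} {z : ℝ × ℝ} {r : ℝ}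
    (hDB : {p : ℝ × ℝ | (p.1 - z.1) ^ 2 + (p.2 - z.2) ^ 2 ≤ r ^ 2} ⊆ ball2)
    (hc : ContinuousOn w ball2) (heven : ∀ p : ℝ × ℝ, w (p.1, -p.2) = w p)
    (hoff : ∀ p ∈ ball2, p.2 ≠ 0 → ContDiffAt ℝ 2 w p ∧ lap2 w p = 0)
    (hax : ∀ x : ℝ, (x, (0 : ℝ)) ∈ ball2 → 0 < w (x, 0) → ∃ L : ℝ, 0 ≤ L ∧
      Filter.Tendsto (fun t => (w (x, t) - w (x, 0)) / t) (nhdsWithin 0 (Ioi 0)) (nhds L))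
    (hR : ∀ p : ℝ × ℝ, (p.1 - z.1) ^ 2 + (p.2 - z.2) ^ 2 ≤ r ^ 2 → 0 ≤ rePoly R p)
    (hbd : ∀ p : ℝ × ℝ, (p.1 - z.1) ^ 2 + (p.2 - z.2) ^ 2 = r ^ 2 → w p ≤ rePoly R p)
    {p : ℝ × ℝ} (hp : (p.1 - z.1) ^ 2 + (p.2 - z.2) ^ 2 ≤ r ^ 2) : w p ≤ rePoly R p := by
  by_contra! hlt
  set D : Set (ℝ × ℝ) := {p : ℝ × ℝ | (p.1 - z.1) ^ 2 + (p.2 - z.2) ^ 2 ≤ r ^ 2}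
  have hbound : ∀ q ∈ D, q.1 ^ 2 + q.2 ^ 2 < 4 ∧ |q.2| ≤ 2 := by
    intro q hq
    have h4 : q.1 ^ 2 + q.2 ^ 2 < 4 := hDB hq
    exact ⟨h4, abs_le_of_sq_le_sq (by nlinarith [sq_nonneg q.1]) (by norm_num)⟩
  have hDc : IsCompact D := by
    refine Metric.isCompact_of_isClosed_isBounded (isClosed_le (by fun_prop) (by fun_prop)) ?_
    refine (Metric.isBounded_closedBall (x := (0 : ℝ × ℝ)) (r := 2)).subset fun q hq => ?_
    rw [mem_closedBall_zero_iff, Prod.norm_def, max_le_iff]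
    obtain ⟨h4, h2⟩ := hbound q hq
    exact ⟨abs_le_of_sq_le_sq (by nlinarith [sq_nonneg q.2]) (by norm_num), h2⟩
  obtain ⟨ε, hε, hεd⟩ : ∃ ε : ℝ, 0 < ε ∧ ε * 6 < w p - rePoly R p :=
    ⟨(w p - rePoly R p) / 12, by linarith, by linarith⟩
  set g : ℝ × ℝ → ℝ := fun q => w q - rePoly R q + ε * |q.2| + ε * (q.1 ^ 2 + q.2 ^ 2) with hg
  have hgc : ContinuousOn g D := by
    have := (contDiff_rePoly R).continuous
    have := hc.mono hDB
    fun_prop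
  obtain ⟨q, hqD, hqmax⟩ := hDc.exists_isMaxOn ⟨p, hp⟩ hgc
  have hwq : rePoly R q < w q := by
    have h₁ : g p ≤ g q := hqmax hp
    obtain ⟨h₂, h₃⟩ := hbound q hqD
    simp only [hg] at h₁
    nlinarith [mul_nonneg hε.le (abs_nonneg p.2),
      mul_nonneg hε.le (add_nonneg (sq_nonneg p.1) (sq_nonneg p.2))]
  have hqint : (q.1 - z.1) ^ 2 + (q.2 - z.2) ^ 2 < r ^ 2 :=
    lt_of_le_of_ne hqD fun h => (hbd q h).not_gt hwq
  have hDnhds : D ∈ nhds q := by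
    have : IsOpen {p : ℝ × ℝ | (p.1 - z.1) ^ 2 + (p.2 - z.2) ^ 2 < r ^ 2} :=
      isOpen_lt (by fun_prop) (by fun_prop)
    filter_upwards [this.mem_nhds hqint] with a ha
    exact (show (a.1 - z.1) ^ 2 + (a.2 - z.2) ^ 2 < r ^ 2 from ha).le
  by_cases hq0 : q.2 = 0
  · obtain ⟨x, y⟩ := q
    obtain rfl : y = 0 := hq0
    obtain ⟨L, hL, hlim⟩ := hax x (hDB hqD) ((hR _ hqD).trans_lt hwq)
    set a := rePoly (Polynomial.C Complex.I * R.derivative) (x, 0)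
    have h₁ : HasDerivAt (fun t => rePoly R (x, t)) a 0 := hasDerivAt_rePoly_snd R x 0
    have h₂ : HasDerivAt (fun t => rePoly R (x, -t)) (-a) 0 := by
      have h₁' : HasDerivAt (fun t => rePoly R (x, t)) a (-0) := by simpa using h₁
      simpa [Function.comp_def] using h₁'.comp 0 (hasDerivAt_neg 0)
    have ht : Filter.Tendsto (fun t : ℝ => t) (nhdsWithin 0 (Ioi 0)) (nhds 0) :=
      nhdsWithin_le_nhds
    have hsum := ((((hlim.const_mul 2).sub h₁.tendsto_slope_zero_right).sub
      h₂.tendsto_slope_zero_right).add_const (2 * ε)).add (ht.const_mul (2 * ε))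
    have hle : 2 * L - a - -a + 2 * ε + 2 * ε * 0 ≤ 0 := by
      refine le_of_tendsto hsum ?_
      have c₁ : ∀ᶠ t in nhdsWithin (0 : ℝ) (Ioi 0), (x, t) ∈ D :=
        nhdsWithin_le_nhds ((by fun_prop : ContinuousAt (fun t : ℝ => (x, t)) 0) hDnhds)
      have c₂ : ∀ᶠ t in nhdsWithin (0 : ℝ) (Ioi 0), (x, -t) ∈ D := by
        have : ContinuousAt (fun t : ℝ => (x, -t)) 0 := by fun_prop
        exact nhdsWithin_le_nhds (this (by simpa using hDnhds))
      filter_upwards [c₁, c₂, self_mem_nhdsWithin] with t ht₁ ht₂ ht₀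
      have ht₀ : 0 < t := ht₀
      have m₁ : g (x, t) ≤ g (x, 0) := hqmax ht₁
      have m₂ : g (x, -t) ≤ g (x, 0) := hqmax ht₂
      have e := heven (x, t)
      simp only [hg, abs_neg, abs_of_pos ht₀, abs_zero] at m₁ m₂ e
      rw [e] at m₂
      have : 2 * ((w (x, t) - w (x, 0)) / t) - t⁻¹ • (rePoly R (x, 0 + t) - rePoly R (x, 0)) -
          t⁻¹ • (rePoly R (x, -(0 + t)) - rePoly R (x, -0)) + 2 * ε + 2 * ε * t =
          (2 * (w (x, t) - w (x, 0)) - (rePoly R (x, t) - rePoly R (x, 0)) -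
            (rePoly R (x, -t) - rePoly R (x, 0)) + 2 * ε * t + 2 * ε * t ^ 2) / t := by
        simp only [zero_add, neg_zero, smul_eq_mul]
        field_simp
      rw [this]
      exact div_nonpos_of_nonpos_of_nonneg (by nlinarith) ht₀.le
    linarith
  · obtain ⟨s, hs, hsq⟩ : ∃ s : ℝ, (∀ y : ℝ, s * y ≤ |y|) ∧ s * q.2 = |q.2| := by
      rcases le_total 0 q.2 with h | h
      · exact ⟨1, fun y => by simpa using le_abs_self y, by simp [abs_of_nonneg h]⟩
      · exact ⟨-1, fun y => by simpa using neg_le_abs y, by simp [abs_of_nonpos h]⟩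
    obtain ⟨hw₁, hw₂⟩ := hoff q (hDB hqD) hq0
    have hG : ContDiffAt ℝ 2 (fun q : ℝ × ℝ =>
        rePoly R q - (ε * s) * q.2 - ε * (q.1 ^ 2 + q.2 ^ 2)) q := by
      have := (contDiff_rePoly R).contDiffAt (x := q)
      fun_prop
    have hmax : IsLocalMax (fun q => w q - (rePoly R q - (ε * s) * q.2 -
        ε * (q.1 ^ 2 + q.2 ^ 2))) q := by
      filter_upwards [hDnhds] with b hb
      have h₁ : g b ≤ g q := hqmax hb
      simp only [hg] at h₁
      have h₂ := mul_le_mul_of_nonneg_left (hs b.2) hε.le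
      have h₃ : ε * s * q.2 = ε * |q.2| := by rw [mul_assoc, hsq]
      linarith
    have hlap := lap2_nonpos_of_isLocalMax
      (ContinuousAt.fun_sub hw₁.continuousAt hG.continuousAt) hmax
    rw [lap2_sub hw₁ hG, lap2_rePoly_sub, hw₂] at hlap
    linarith

theorem FinUnionIntervals.isClosed {K : Set ℝ} (hK : FinUnionIntervals K) : IsClosed K := by
  obtain ⟨N, a, b, -, -, -, rfl⟩ := hK
  exact isClosed_iUnion_of_finite fun i => isClosed_Icc

theorem isOpen_ball2 : IsOpen ball2 := isOpen_lt (by fun_prop) (by fun_prop)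

theorem isOpen_ball2_diff {K : Set ℝ} (hK : IsClosed K) :
    IsOpen (ball2 \ {p : ℝ × ℝ | p.1 ∈ K ∧ p.2 = 0}) :=
  isOpen_ball2.sdiff ((hK.preimage continuous_fst).inter (isClosed_eq continuous_snd
    continuous_const))

theorem HarmonicOn2.contDiffAt {u : ℝ × ℝ → ℝ} {K : Set ℝ} (hK : IsClosed K)
    (hu : HarmonicOn2 u (ball2 \ {p : ℝ × ℝ | p.1 ∈ K ∧ p.2 = 0})) {p : ℝ × ℝ}
    (hp : p ∈ ball2 \ {p : ℝ × ℝ | p.1 ∈ K ∧ p.2 = 0}) : ContDiffAt ℝ 2 u p :=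
  hu.1.contDiffAt ((isOpen_ball2_diff hK).mem_nhds hp)

theorem tendsto_slope_zero_of_even {f : ℝ → ℝ} (hf : DifferentiableAt ℝ f 0)
    (heven : ∀ t, f (-t) = f t) :
    Filter.Tendsto (fun t => (f t - f 0) / t) (nhdsWithin 0 (Ioi 0)) (nhds 0) := by
  have h₁ := hf.hasDerivAt
  have h₂ : deriv f 0 = 0 := by
    have h₁' : HasDerivAt f (deriv f 0) (-0) := by simpa using h₁
    have h₃ := h₁'.comp 0 (hasDerivAt_neg 0)
    have h₄ : f ∘ Neg.neg = f := funext heven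
    rw [h₄] at h₃
    linarith [h₃.unique h₁]
  rw [h₂] at h₁
  refine h₁.tendsto_slope_zero_right.congr fun t => ?_
  simp [div_eq_inv_mul]

/-- The one-sided vertical derivative of a solution exists at every point of the axis, and
vanishes away from `K`. -/
theorem TwoPhaseSol2.exists_tendsto_slope {θ : ℝ} {K : Set ℝ} {φ : ℝ → ℝ} {u : ℝ × ℝ → ℝ}
    {ψ : ℝ → ℝ} (hu : TwoPhaseSol2 θ K φ u ψ) (hK : IsClosed K)
    (heven : ∀ p : ℝ × ℝ, u (p.1, -p.2) = u p) {x : ℝ} (hx : (x, (0 : ℝ)) ∈ ball2) :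
    ∃ a : ℝ, Filter.Tendsto (fun t => (u (x, t) - u (x, 0)) / t)
      (nhdsWithin 0 (Ioi 0)) (nhds a) ∧ (x ∈ K → a = ψ x) ∧ (x ∉ K → a = 0) := by
  by_cases hxK : x ∈ K
  · exact ⟨ψ x, (hu.2 x hxK hx).1, fun _ => rfl, fun h => absurd hxK h⟩
  · refine ⟨0, ?_, fun h => absurd h hxK, fun _ => rfl⟩
    have hd := (hu.1.contDiffAt hK (p := (x, 0)) ⟨hx, fun h => hxK h.1⟩).differentiableAt
      (by norm_num)
    refine tendsto_slope_zero_of_even (f := fun t => u (x, t)) ?_ fun t => heven (x, t)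
    exact hd.comp (0 : ℝ) (f := fun t : ℝ => (x, t)) (by fun_prop)

/-- Comparison principle for the two-phase problem: if `u, v` solve the
two-phase problem in `B₂` on `K_u ⊇ K_v` with obstacles `φ_u ≥ φ_v` on `K_v`, then
`(v − u)₊` is subharmonic in `B₂` in the sense of the sub-mean value property on circles. -/
theorem statement10
    (θ : ℝ) (hθ : 0 < θ)
    (Ku Kv : Set ℝ) (hKu : FinUnionIntervals Ku) (hKv : FinUnionIntervals Kv)
    (hKvu : Kv ⊆ Ku)
    (φu φv : ℝ → ℝ) (hφu : ContinuousOn φu Ku) (hφv : ContinuousOn φv Kv)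
    (hord : ∀ x₁ ∈ Kv, φv x₁ ≤ φu x₁)
    (u v : ℝ × ℝ → ℝ) (ψu ψv : ℝ → ℝ)
    (hu_cont : ContinuousOn u ball2) (hv_cont : ContinuousOn v ball2)
    (hu_even : ∀ p : ℝ × ℝ, u (p.1, -p.2) = u p)
    (hv_even : ∀ p : ℝ × ℝ, v (p.1, -p.2) = v p)
    (hu : TwoPhaseSol2 θ Ku φu u ψu) (hv : TwoPhaseSol2 θ Kv φv v ψv) :
    ∀ z ∈ ball2, ∀ r > 0,
      {p : ℝ × ℝ | (p.1 - z.1)^2 + (p.2 - z.2)^2 ≤ r^2} ⊆ ball2 →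
      max (v z - u z) 0 ≤ (2 * Real.pi)⁻¹ *
        ∫ t in (0:ℝ)..(2 * Real.pi),
          max (v (z.1 + r * Real.cos t, z.2 + r * Real.sin t)
               - u (z.1 + r * Real.cos t, z.2 + r * Real.sin t)) 0 := by
  intro z hz r hr hDB
  have hcKu := hKu.isClosed
  have hcKv := hKv.isClosed
  set f : ℝ → ℝ := fun t => max (v (z.1 + r * Real.cos t, z.2 + r * Real.sin t)
    - u (z.1 + r * Real.cos t, z.2 + r * Real.sin t)) 0 with hf
  have hcirc : ∀ t : ℝ, (z.1 + r * Real.cos t, z.2 + r * Real.sin t) ∈ ball2 := fun t =>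
    hDB (by
      simp only [mem_ofPred_eq, add_sub_cancel_left]
      nlinarith [Real.sin_sq_add_cos_sq t])
  have hfc : Continuous f := by
    have hγ : Continuous fun t : ℝ => (z.1 + r * Real.cos t, z.2 + r * Real.sin t) := by
      fun_prop
    exact ((hv_cont.comp_continuous hγ hcirc).sub (hu_cont.comp_continuous hγ hcirc)).max
      continuous_const
  have hper : Function.Periodic f (2 * Real.pi) := fun t => by
    simp [hf, Real.cos_add_two_pi, Real.sin_add_two_pi]
  refine le_of_forall_pos_le_add fun η hη => ?_
  obtain ⟨R₀, hR₀⟩ := exists_rePoly_near_on_circle hfc hper z hr (half_pos hη)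
  set R : Polynomial ℂ := R₀ + Polynomial.C ((η / 2 : ℝ) : ℂ) with hRdef
  have hRe : ∀ p, rePoly R p = rePoly R₀ p + η / 2 := fun p => by
    simp only [rePoly, hRdef, Polynomial.eval_add, Polynomial.eval_C, Complex.add_re,
      Complex.ofReal_re]
  have hnear : ∀ t : ℝ, f t ≤ rePoly R (z.1 + r * Real.cos t, z.2 + r * Real.sin t) ∧
      rePoly R (z.1 + r * Real.cos t, z.2 + r * Real.sin t) ≤ f t + η := fun t => by
    have := abs_lt.mp (hR₀ t)
    rw [hRe]
    constructor <;> linarith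
  have hnonneg := fun p : ℝ × ℝ => rePoly_nonneg_of_circle (R := R) (p := p) hr fun t =>
    (le_max_right _ _).trans (hnear t).1
  have hcenter : (z.1 - z.1) ^ 2 + (z.2 - z.2) ^ 2 ≤ r ^ 2 := by
    simpa using sq_nonneg r
  have hle : v z - u z ≤ rePoly R z := by
    refine le_rePoly_of_le_on_circle (w := fun p => v p - u p) hDB (hv_cont.sub hu_cont)
      (fun p => by simp only [hu_even, hv_even]) ?_ ?_ hnonneg ?_ hcenter
    · intro p hp hp2
      have hpu : p ∈ ball2 \ {p : ℝ × ℝ | p.1 ∈ Ku ∧ p.2 = 0} := ⟨hp, fun h => hp2 h.2⟩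
      have hpv : p ∈ ball2 \ {p : ℝ × ℝ | p.1 ∈ Kv ∧ p.2 = 0} := ⟨hp, fun h => hp2 h.2⟩
      have hu₁ := hu.1.contDiffAt hcKu hpu
      have hv₁ := hv.1.contDiffAt hcKv hpv
      exact ⟨hv₁.sub hu₁, by rw [lap2_sub hv₁ hu₁, hu.1.2 p hpu, hv.1.2 p hpv, sub_zero]⟩
    · intro x hx hpos
      obtain ⟨a, ha, haK, ha0⟩ := hu.exists_tendsto_slope hcKu hu_even hx
      obtain ⟨b, hb, hbK, hb0⟩ := hv.exists_tendsto_slope hcKv hv_even hx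
      refine ⟨b - a, ?_, (hb.sub ha).congr fun t => by ring⟩
      by_cases hxv : x ∈ Kv
      · obtain ⟨-, hv₁, -, hv₂, -⟩ := hv.2 x hxv hx
        obtain ⟨-, -, hu₁, -, hu₂⟩ := hu.2 x (hKvu hxv) hx
        rw [haK (hKvu hxv), hbK hxv]
        rcases lt_or_ge (u (x, 0)) (φu x) with h | h
        · linarith [hu₂ h]
        · linarith [hv₂ (by linarith [hord x hxv])]
      · rw [hb0 hxv]
        by_cases hxu : x ∈ Ku
        · rw [haK hxu]
          linarith [(hu.2 x hxu hx).2.2.1]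
        · rw [ha0 hxu, sub_zero]
    · intro p hp
      obtain ⟨t, rfl⟩ := exists_angle_of_mem_circle hr hp
      exact (le_max_left _ _).trans (hnear t).1
  have havg : rePoly R z ≤ (2 * Real.pi)⁻¹ * (∫ t in (0:ℝ)..(2 * Real.pi), f t) + η := by
    have hint : ∫ t in (0:ℝ)..(2 * Real.pi),
        rePoly R (z.1 + r * Real.cos t, z.2 + r * Real.sin t) ≤
        ∫ t in (0:ℝ)..(2 * Real.pi), (f t + η) := by
      refine intervalIntegral.integral_mono Real.two_pi_pos.le
        (Continuous.intervalIntegrable ?_ _ _)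
        ((hfc.add continuous_const).intervalIntegrable _ _) fun t => (hnear t).2
      exact (contDiff_rePoly R).continuous.comp (by fun_prop)
    rw [intervalIntegral.integral_add (hfc.intervalIntegrable _ _)
      (continuous_const.intervalIntegrable _ _), intervalIntegral.integral_const, sub_zero,
      smul_eq_mul] at hint
    rw [← rePoly_eq_average R z r]
    calc _ ≤ (2 * Real.pi)⁻¹ * ((∫ t in (0:ℝ)..(2 * Real.pi), f t) + 2 * Real.pi * η) := by
          gcongr
      _ = _ := by
          have := Real.pi_ne_zero
          field_simp
  exact (max_le hle (hnonneg z hcenter)).trans havg
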